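/- Assume P satisfies a margin condition with radius r_0 and is ε-separated. Then for every codebook c ∈ B(0,M)^k, (1/(16M²)) Var_P( γ(c,·) − γ(c*(c),·) ) ≤ ‖c − c*(c)‖² ≤ κ_0 (R(c) − R(c*)), where γ(c,x) = min_{1≤j≤k} ‖x−c_j‖², c*(c) is a closest optimal codebook to c (a minimizer of ‖c − c*‖ over c* ∈ 𝓜), and κ_0 = 4kM² · max( 1/ε, 64M²/(p_min B² r_0²) ). -/

import Mathlib

open MeasureTheory Metric
open scoped Classical ENNReal NNReal BigOperators RealInnerProductSpace

noncomputable section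

namespace Kmeans


variable {H : Type*} [NormedAddCommGroup H] [InnerProductSpace ℝ H]
  [MeasurableSpace H]

/-- Distortion of a codebook `c` with respect to the measure `P`. -/
def distortion (P : Measure H) (k : ℕ) (c : Fin k → H) : ℝ :=
  ∫ x, (⨅ j : Fin k, ‖x - c j‖ ^ 2) ∂P

/-- The `j`-th closed Voronoi cell of the codebook `c`. -/
def voronoi (k : ℕ) (c : Fin k → H) (j : Fin k) : Set H :=
  {x : H | ∀ i : Fin k, ‖x - c j‖ ≤ ‖x - c i‖}

/-- The set `𝓜` of optimal codebooks, i.e. minimizers of the distortion. -/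
def optimal (P : Measure H) (k : ℕ) : Set (Fin k → H) :=
  {c | ∀ c' : Fin k → H, distortion P k c ≤ distortion P k c'}

/-- `B`: minimal separation between two codepoints of an optimal codebook. -/
def Bsep (P : Measure H) (k : ℕ) : ℝ :=
  sInf {r : ℝ | ∃ c ∈ optimal P k, ∃ i j : Fin k, i ≠ j ∧ r = ‖c i - c j‖}

/-- `p_min`: minimal mass of a Voronoi cell of an optimal codebook. -/
def pmin (P : Measure H) (k : ℕ) : ℝ :=
  sInf {r : ℝ | ∃ c ∈ optimal P k, ∃ j : Fin k, r = (P (voronoi k c j)).toReal}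

/-- `N(c)`: the skeleton of the Voronoi diagram of `c`. -/
def Ncrit (k : ℕ) (c : Fin k → H) : Set H :=
  ⋃ (i : Fin k) (j : Fin k) (_ : i ≠ j), {x : H | ‖x - c i‖ = ‖x - c j‖}

/-- `p(t)`: maximal mass of the `t`-neighborhood of the skeleton of an optimal codebook. -/
def pweight (P : Measure H) (k : ℕ) (t : ℝ) : ℝ :=
  sSup {r : ℝ | ∃ c ∈ optimal P k, r = (P {x : H | infDist x (Ncrit k c) ≤ t}).toReal}

/-- `P` is `M`-bounded: its support is contained in the closed ball of radius `M`. -/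
def MBounded (P : Measure H) (M : ℝ) : Prop :=
  P (closedBall (0 : H) M) = 1

/-- The support of `P` contains more than `k` points. -/
def SupportMoreThan (P : Measure H) (k : ℕ) : Prop :=
  ∃ S : Finset H, k < S.card ∧ ∀ x ∈ S, ∀ ε : ℝ, 0 < ε → 0 < P (ball x ε)

/-- The margin condition with radius `r₀`. -/
def MarginCondition (P : Measure H) (k : ℕ) (M r₀ : ℝ) : Prop :=
  0 < r₀ ∧ MBounded P M ∧
    ∀ t : ℝ, 0 ≤ t → t ≤ r₀ →
      pweight P k t ≤ Bsep P k * pmin P k * t / (128 * M ^ 2)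

/-- The cells `W_j(c)` forming a partition subordinated to the Voronoi diagram. -/
def Wcell (k : ℕ) (c : Fin k → H) (j : Fin k) : Set H :=
  voronoi k c j \ ⋃ (i : Fin k) (_ : i < j), voronoi k c i

/-- `𝓜‾`: codebooks satisfying the centroid condition (stationary points). -/
def stationary (P : Measure H) (k : ℕ) : Set (Fin k → H) :=
  {c | ∀ i : Fin k, (P (Wcell k c i)).toReal • c i = ∫ x in Wcell k c i, x ∂P}

/-- `P` is `ε`-separated. -/
def Separated (P : Measure H) (k : ℕ) (ε : ℝ) : Prop :=
  ∀ c ∈ stationary P k \ optimal P k, ∀ cs ∈ optimal P k,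
    ε ≤ distortion P k c - distortion P k cs

/-- Euclidean distance between codebooks. -/
def cbDist (k : ℕ) (c c' : Fin k → H) : ℝ :=
  Real.sqrt (∑ j : Fin k, ‖c j - c' j‖ ^ 2)

/-- The empirical measure of a sample. -/
def empMeasure {n : ℕ} (X : Fin n → H) : Measure H :=
  ((n : ℝ≥0∞))⁻¹ • ∑ i : Fin n, Measure.dirac (X i)

/-- Number of optimal codebooks up to relabeling of codepoints. -/
def MbarCard (P : Measure H) (k : ℕ) : ℕ :=
  Set.ncard {s : Set (Fin k → H) |
    ∃ c ∈ optimal P k, s = {c' | ∃ π : Equiv.Perm (Fin k), c' = c ∘ π}}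

/-- The mass `p_{ij}(c,t)` of a slab along the segment `[c_i, c_j]` intersected with `V_j(c)`. -/
def pij (P : Measure H) (k : ℕ) (c : Fin k → H) (i j : Fin k) (t : ℝ) : ℝ :=
  (P ({x : H |
      0 ≤ ⟪x - (2⁻¹ : ℝ) • (c i + c j), ‖c i - c j‖⁻¹ • (c j - c i)⟫ ∧
      ⟪x - (2⁻¹ : ℝ) • (c i + c j), ‖c i - c j‖⁻¹ • (c j - c i)⟫ ≤ t} ∩
    voronoi k c j)).toReal

/-- The classification risk between two (ordered) partitions. -/
def classifRisk (P : Measure H) (k : ℕ) (C C' : Fin k → Set H) : ℝ :=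
  sInf {r : ℝ | ∃ π : Equiv.Perm (Fin k),
    r = (P (⋃ j : Fin k, C (π j) ∩ (C' j)ᶜ)).toReal}

/-- A sample is `f`-clusterable. -/
def Clusterable {n : ℕ} (X : Fin n → H) (k : ℕ) (f : ℝ) : Prop :=
  ∃ c ∈ optimal (empMeasure X) k, ∀ i j : Fin k, i ≠ j →
    f * Real.sqrt (distortion (empMeasure X) k c) *
      (1 / Real.sqrt ((Finset.univ.filter fun a => X a ∈ voronoi k c i).card) +
       1 / Real.sqrt ((Finset.univ.filter fun a => X a ∈ voronoi k c j).card))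
      ≤ ‖c i - c j‖

/-- Membership in the class `𝓓(B₋, r₀₋, p₋, ε₋)` of distributions. -/
def inClassD (P : Measure H) (k : ℕ) (M Bm rm pm em : ℝ) : Prop :=
  IsProbabilityMeasure P ∧ SupportMoreThan P k ∧
    (∃ r₀ : ℝ, rm ≤ r₀ ∧ MarginCondition P k M r₀) ∧
    Bm ≤ Bsep P k ∧ pm ≤ pmin P k ∧ Separated P k em

end Kmeans

open Kmeans

variable {H : Type*} [NormedAddCommGroup H] [InnerProductSpace ℝ H]
  [MeasurableSpace H] [BorelSpace H] [SecondCountableTopology H] [CompleteSpace H]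

set_option linter.unusedSectionVars false

namespace Kmeans

/-- Squared distance from `x` to the nearest codepoint of `c`. -/
def minSqDist (k : ℕ) (c : Fin k → H) (x : H) : ℝ := ⨅ j : Fin k, ‖x - c j‖ ^ 2

section Pointwise

variable {k : ℕ}

theorem minSqDist_le (c : Fin k → H) (x : H) (j : Fin k) : minSqDist k c x ≤ ‖x - c j‖ ^ 2 :=
  ciInf_le (Set.finite_range _).bddBelow j

theorem minSqDist_nonneg (c : Fin k → H) (x : H) : 0 ≤ minSqDist k c x :=
  Real.iInf_nonneg fun _ => sq_nonneg _

theorem minSqDist_eq_of_mem_voronoi {c : Fin k → H} {x : H} {j : Fin k}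
    (hx : x ∈ voronoi k c j) : minSqDist k c x = ‖x - c j‖ ^ 2 :=
  have : Nonempty (Fin k) := ⟨j⟩
  le_antisymm (minSqDist_le c x j)
    (le_ciInf fun i => pow_le_pow_left₀ (norm_nonneg _) (hx i) 2)

theorem minSqDist_eq_of_mem_Wcell {c : Fin k → H} {x : H} {j : Fin k}
    (hx : x ∈ Wcell k c j) : minSqDist k c x = ‖x - c j‖ ^ 2 :=
  minSqDist_eq_of_mem_voronoi hx.1

theorem exists_mem_Wcell [NeZero k] (c : Fin k → H) (x : H) : ∃ j, x ∈ Wcell k c j := by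
  obtain ⟨i, -, hi⟩ := Finset.exists_min_image Finset.univ (fun i => ‖x - c i‖)
    ⟨(0 : Fin k), Finset.mem_univ _⟩
  obtain ⟨j, hj, hmin⟩ := WellFounded.has_min (wellFounded_lt (α := Fin k))
    {j | x ∈ voronoi k c j} ⟨i, fun l => hi l (Finset.mem_univ _)⟩
  refine ⟨j, hj, ?_⟩
  simp only [Set.mem_iUnion, not_exists]
  exact fun l hl hx => hmin l hx hl

theorem iUnion_Wcell [NeZero k] (c : Fin k → H) : ⋃ j, Wcell k c j = Set.univ :=
  Set.eq_univ_of_forall fun x => Set.mem_iUnion.2 (exists_mem_Wcell c x)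

theorem pairwise_disjoint_Wcell (c : Fin k → H) :
    Pairwise (Function.onFun Disjoint (Wcell k c)) := by
  have key : ∀ i j : Fin k, i < j → Disjoint (Wcell k c i) (Wcell k c j) := by
    intro i j hij
    refine Set.disjoint_left.2 fun x hi hj => hj.2 ?_
    simp only [Set.mem_iUnion]
    exact ⟨i, hij, hi.1⟩
  intro i j hij
  rcases lt_or_gt_of_ne hij with h | h
  · exact key i j h
  · exact (key j i h).symm

theorem minSqDist_update_le {c : Fin k → H} {x y : H} {i j : Fin k} (hij : i ≠ j)
    (hy : y ∈ Wcell k c j) : minSqDist k (Function.update c i x) y ≤ minSqDist k c y := by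
  rw [minSqDist_eq_of_mem_Wcell hy]
  simpa [Function.update_of_ne hij.symm] using minSqDist_le (Function.update c i x) y j

theorem norm_sub_sq_sub_norm_sub_sq_le {M : ℝ} {x a b : H} (hx : ‖x‖ ≤ M) (ha : ‖a‖ ≤ M)
    (hb : ‖b‖ ≤ M) : |‖x - a‖ ^ 2 - ‖x - b‖ ^ 2| ≤ 4 * M * ‖a - b‖ := by
  have h1 : |‖x - a‖ - ‖x - b‖| ≤ ‖a - b‖ := by
    have := abs_norm_sub_norm_le (x - a) (x - b)
    rwa [sub_sub_sub_cancel_left, norm_sub_rev b a] at this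
  have h2 : ‖x - a‖ + ‖x - b‖ ≤ 4 * M := by
    linarith [norm_sub_le x a, norm_sub_le x b]
  rw [sq_sub_sq, abs_mul, abs_of_nonneg (by positivity)]
  exact mul_le_mul h2 h1 (abs_nonneg _) (by linarith [norm_nonneg x])

theorem infDist_Ncrit_mul_le {c : Fin k → H} {x : H} {i j : Fin k} (hij : c i ≠ c j)
    (hx : ‖x - c i‖ ≤ ‖x - c j‖) :
    2 * ‖c i - c j‖ * infDist x (Ncrit k c) ≤ ‖x - c j‖ ^ 2 - ‖x - c i‖ ^ 2 := by
  have hne : i ≠ j := fun h => hij (by rw [h])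
  have hpos : 0 < ‖c j - c i‖ := norm_pos_iff.2 (sub_ne_zero.2 hij.symm)
  set s : ℝ := (‖x - c j‖ ^ 2 - ‖x - c i‖ ^ 2) / (2 * ‖c j - c i‖ ^ 2) with hs
  have hs0 : 0 ≤ s := by
    apply div_nonneg _ (by positivity)
    have := pow_le_pow_left₀ (norm_nonneg _) hx 2
    linarith
  have hsmul : s * (2 * ‖c j - c i‖ ^ 2) = ‖x - c j‖ ^ 2 - ‖x - c i‖ ^ 2 :=
    div_mul_cancel₀ _ (by positivity)
  have hmem : x + s • (c j - c i) ∈ Ncrit k c := by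
    simp only [Ncrit, Set.mem_iUnion]
    refine ⟨i, j, hne, ?_⟩
    have h1 : x + s • (c j - c i) - c i = (x - c i) + s • (c j - c i) := by abel
    have h2 : x + s • (c j - c i) - c j = (x - c j) + s • (c j - c i) := by abel
    have h3 : x - c j = (x - c i) - (c j - c i) := by abel
    have hsq : ‖x + s • (c j - c i) - c i‖ ^ 2 = ‖x + s • (c j - c i) - c j‖ ^ 2 := by
      rw [h3] at hsmul
      rw [h1, h2, h3]
      generalize x - c i = z at hsmul ⊢
      generalize c j - c i = w at hsmul ⊢
      rw [norm_add_sq_real, norm_add_sq_real, inner_sub_left, inner_smul_right, inner_smul_right,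
        real_inner_self_eq_norm_sq]
      have := norm_sub_sq_real z w
      linarith
    exact (pow_left_inj₀ (norm_nonneg _) (norm_nonneg _) two_ne_zero).1 hsq
  have hd : infDist x (Ncrit k c) ≤ s * ‖c j - c i‖ := by
    refine (infDist_le_dist_of_mem hmem).trans_eq ?_
    rw [dist_eq_norm, sub_add_cancel_left, norm_neg, norm_smul, Real.norm_of_nonneg hs0]
  rw [norm_sub_rev (c i)]
  nlinarith [mul_le_mul_of_nonneg_left hd hpos.le]

theorem voronoi_subset_Wcell_union_Ncrit (c : Fin k → H) (j : Fin k) :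
    voronoi k c j ⊆ Wcell k c j ∪ Ncrit k c := by
  intro x hx
  by_cases h : x ∈ ⋃ (i : Fin k) (_ : i < j), voronoi k c i
  · right
    simp only [Set.mem_iUnion] at h
    obtain ⟨i, hij, hi⟩ := h
    simp only [Ncrit, Set.mem_iUnion]
    exact ⟨i, j, hij.ne, le_antisymm (hi j) (hx i)⟩
  · exact Or.inl ⟨hx, h⟩

theorem injective_of_Wcell_nonempty {c : Fin k → H} (h : ∀ i, (Wcell k c i).Nonempty) :
    Function.Injective c := by
  have key : ∀ i j : Fin k, i < j → c i ≠ c j := by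
    intro i j hij hc
    obtain ⟨x, hx⟩ := h j
    refine hx.2 ?_
    simp only [Set.mem_iUnion]
    exact ⟨i, hij, fun l => hc ▸ hx.1 l⟩
  intro i j hc
  by_contra hne
  rcases lt_or_gt_of_ne hne with h | h
  · exact key i j h hc
  · exact key j i h hc.symm

end Pointwise

section Measurability

variable {k : ℕ}

theorem measurable_minSqDist (c : Fin k → H) : Measurable (minSqDist k c) :=
  Measurable.iInf fun j => by fun_prop

theorem measurableSet_voronoi (c : Fin k → H) (j : Fin k) : MeasurableSet (voronoi k c j) := by
  have : voronoi k c j = ⋂ i, {x | ‖x - c j‖ ≤ ‖x - c i‖} := by ext; simp [voronoi]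
  rw [this]
  exact MeasurableSet.iInter fun i => measurableSet_le (by fun_prop) (by fun_prop)

theorem measurableSet_Wcell (c : Fin k → H) (j : Fin k) : MeasurableSet (Wcell k c j) :=
  (measurableSet_voronoi c j).diff
    (MeasurableSet.iUnion fun i => MeasurableSet.iUnion fun _ => measurableSet_voronoi c i)

end Measurability

section Integrals

variable {k : ℕ} {M : ℝ} {P : Measure H} [IsProbabilityMeasure P]

theorem MBounded.ae_norm_le (h : MBounded P M) : ∀ᵐ x ∂P, ‖x‖ ≤ M := by
  have := (mem_ae_iff_prob_eq_one (μ := P) (isClosed_closedBall.measurableSet)).2 h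
  filter_upwards [this] with x hx
  simpa using hx

theorem integrable_id_of_ae_norm_le (hP : ∀ᵐ x ∂P, ‖x‖ ≤ M) : Integrable (fun x : H => x) P :=
  Integrable.of_bound measurable_id.aestronglyMeasurable M hP

theorem integrable_norm_sub_sq (hP : ∀ᵐ x ∂P, ‖x‖ ≤ M) (a : H) :
    Integrable (fun x => ‖x - a‖ ^ 2) P := by
  refine Integrable.of_bound (by fun_prop : Measurable _).aestronglyMeasurable ((M + ‖a‖) ^ 2) ?_
  filter_upwards [hP] with x hx
  rw [Real.norm_of_nonneg (sq_nonneg _)]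
  gcongr
  linarith [norm_sub_le x a]

theorem integrable_minSqDist [NeZero k] (hP : ∀ᵐ x ∂P, ‖x‖ ≤ M) (c : Fin k → H) :
    Integrable (minSqDist k c) P := by
  refine (integrable_norm_sub_sq hP (c 0)).mono' (measurable_minSqDist c).aestronglyMeasurable ?_
  filter_upwards with x
  rw [Real.norm_of_nonneg (minSqDist_nonneg c x)]
  exact minSqDist_le c x 0

theorem integral_eq_sum_Wcell [NeZero k] (c : Fin k → H) {f : H → ℝ} (hf : Integrable f P) :
    ∫ x, f x ∂P = ∑ i, ∫ x in Wcell k c i, f x ∂P := by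
  rw [← integral_iUnion_fintype (measurableSet_Wcell c) (pairwise_disjoint_Wcell c)
    fun _ => hf.integrableOn, iUnion_Wcell, setIntegral_univ]

theorem sum_measureReal_Wcell [NeZero k] (c : Fin k → H) : ∑ i, P.real (Wcell k c i) = 1 := by
  have := integral_eq_sum_Wcell (P := P) c (f := fun _ => (1 : ℝ)) (integrable_const _)
  simpa using this.symm

/-- Distortion of the codebook `c` when points are assigned to codepoints by the cells of `a`. -/
def assignedDistortion (P : Measure H) (k : ℕ) (a c : Fin k → H) : ℝ :=
  ∑ i, ∫ x in Wcell k a i, ‖x - c i‖ ^ 2 ∂P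

theorem distortion_eq_assignedDistortion [NeZero k] (hP : ∀ᵐ x ∂P, ‖x‖ ≤ M) (c : Fin k → H) :
    distortion P k c = assignedDistortion P k c c := by
  change ∫ x, minSqDist k c x ∂P = _
  rw [integral_eq_sum_Wcell c (integrable_minSqDist hP c)]
  exact Finset.sum_congr rfl fun i _ => setIntegral_congr_fun (measurableSet_Wcell c i)
    fun x hx => minSqDist_eq_of_mem_Wcell hx

theorem distortion_le_assignedDistortion [NeZero k] (hP : ∀ᵐ x ∂P, ‖x‖ ≤ M) (a c : Fin k → H) :
    distortion P k c ≤ assignedDistortion P k a c := by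
  change ∫ x, minSqDist k c x ∂P ≤ _
  rw [integral_eq_sum_Wcell a (integrable_minSqDist hP c)]
  exact Finset.sum_le_sum fun i _ => setIntegral_mono_on
    (integrable_minSqDist hP c).integrableOn (integrable_norm_sub_sq hP _).integrableOn
    (measurableSet_Wcell a i) fun x _ => minSqDist_le c x i

theorem setIntegral_norm_sub_sq (hP : ∀ᵐ x ∂P, ‖x‖ ≤ M) {A : Set H} {m : H} (b : H)
    (hm : P.real A • m = ∫ x in A, x ∂P) :
    ∫ x in A, ‖x - b‖ ^ 2 ∂P = ∫ x in A, ‖x - m‖ ^ 2 ∂P + P.real A * ‖b - m‖ ^ 2 := by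
  have hid := integrable_id_of_ae_norm_le hP
  have hpt : ∀ x : H, ‖x - b‖ ^ 2 =
      ‖x - m‖ ^ 2 + (‖b - m‖ ^ 2 - 2 * ⟪b - m, x - m⟫) := by
    intro x
    have : x - b = (x - m) - (b - m) := by abel
    rw [this, norm_sub_sq_real, real_inner_comm]
    ring
  have hidm : Integrable (fun x => x - m) (P.restrict A) :=
    (hid.integrableOn (s := A)).sub (integrable_const m)
  have hin : Integrable (fun x => ⟪b - m, x - m⟫) (P.restrict A) := hidm.const_inner (b - m)
  have hzero : ∫ x in A, ⟪b - m, x - m⟫ ∂P = 0 := by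
    rw [integral_inner hidm, integral_sub hid.integrableOn (integrable_const m), ← hm]
    simp
  simp_rw [hpt]
  rw [integral_add (integrable_norm_sub_sq hP m).integrableOn
    (by exact (integrable_const _).sub (hin.const_mul 2)),
    integral_sub (integrable_const _) (hin.const_mul 2), integral_const_mul, hzero]
  simp

theorem assignedDistortion_eq (hP : ∀ᵐ x ∂P, ‖x‖ ≤ M) {a m : Fin k → H}
    (hm : ∀ i, P.real (Wcell k a i) • m i = ∫ x in Wcell k a i, x ∂P) (c : Fin k → H) :
    assignedDistortion P k a c =
      assignedDistortion P k a m + ∑ i, P.real (Wcell k a i) * ‖c i - m i‖ ^ 2 := by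
  simp only [assignedDistortion]
  rw [← Finset.sum_add_distrib]
  exact Finset.sum_congr rfl fun i _ => setIntegral_norm_sub_sq hP (c i) (hm i)

/-- One step of Lloyd's algorithm: codepoints move to the centroids of their cells, those whose
cell has no mass stay. -/
def lloyd (P : Measure H) (k : ℕ) (a : Fin k → H) (i : Fin k) : H :=
  if P.real (Wcell k a i) = 0 then a i
  else (P.real (Wcell k a i))⁻¹ • ∫ x in Wcell k a i, x ∂P

theorem measureReal_smul_lloyd (a : Fin k → H) (i : Fin k) :
    P.real (Wcell k a i) • lloyd P k a i = ∫ x in Wcell k a i, x ∂P := by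
  unfold lloyd
  split_ifs with h
  · have h' : P (Wcell k a i) = 0 := (measureReal_eq_zero_iff).1 h
    rw [h, zero_smul, setIntegral_measure_zero _ h']
  · rw [smul_inv_smul₀ h]

theorem norm_setIntegral_id_le (hP : ∀ᵐ x ∂P, ‖x‖ ≤ M) (A : Set H) :
    ‖∫ x in A, x ∂P‖ ≤ M * P.real A :=
  norm_setIntegral_le_of_norm_le_const_ae (measure_lt_top _ _)
    (ae_restrict_of_ae hP)

theorem norm_lloyd_le (hP : ∀ᵐ x ∂P, ‖x‖ ≤ M) {a : Fin k → H} (ha : ∀ i, ‖a i‖ ≤ M)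
    (i : Fin k) : ‖lloyd P k a i‖ ≤ M := by
  unfold lloyd
  split_ifs with h
  · exact ha i
  · have hpos : 0 < P.real (Wcell k a i) := lt_of_le_of_ne measureReal_nonneg (Ne.symm h)
    rw [norm_smul, norm_inv, Real.norm_of_nonneg hpos.le, inv_mul_le_iff₀ hpos, mul_comm]
    exact norm_setIntegral_id_le hP _

/-- A codebook that Lloyd's algorithm does not improve satisfies the centroid condition. -/
theorem mem_stationary_of_distortion_le_lloyd [NeZero k] (hP : ∀ᵐ x ∂P, ‖x‖ ≤ M)
    {a : Fin k → H} (h : distortion P k a ≤ distortion P k (lloyd P k a)) :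
    a ∈ stationary P k := by
  have h1 := distortion_le_assignedDistortion hP a (lloyd P k a)
  have h2 := assignedDistortion_eq hP (measureReal_smul_lloyd (P := P) a) a
  rw [← distortion_eq_assignedDistortion hP a] at h2
  have h0 : ∀ i ∈ Finset.univ, 0 ≤ P.real (Wcell k a i) * ‖a i - lloyd P k a i‖ ^ 2 :=
    fun i _ => mul_nonneg measureReal_nonneg (sq_nonneg _)
  have h3 := (Finset.sum_eq_zero_iff_of_nonneg h0).1
    (le_antisymm (by linarith) (Finset.sum_nonneg h0))
  intro i
  change P.real (Wcell k a i) • a i = _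
  rw [← measureReal_smul_lloyd a i]
  rcases mul_eq_zero.1 (h3 i (Finset.mem_univ i)) with h | h
  · rw [h, zero_smul, zero_smul]
  · rw [sub_eq_zero.1 (norm_eq_zero.1 (pow_eq_zero_iff two_ne_zero |>.1 h))]

theorem optimal_subset_stationary [NeZero k] (hP : ∀ᵐ x ∂P, ‖x‖ ≤ M) :
    optimal P k ⊆ stationary P k :=
  fun _ hc => mem_stationary_of_distortion_le_lloyd hP (hc _)

end Integrals

section OptimalCells

variable {k : ℕ} {M : ℝ} {P : Measure H} [IsProbabilityMeasure P]

theorem exists_separation {S : Finset H} (hS : 1 < S.card) :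
    ∃ s : ℝ, 0 < s ∧ ∀ x ∈ S, ∀ y ∈ S, x ≠ y → s ≤ dist x y := by
  obtain ⟨a, ha, b, hb, hab⟩ := Finset.one_lt_card.1 hS
  obtain ⟨p, hp, hmin⟩ := Finset.exists_min_image S.offDiag (fun p => dist p.1 p.2)
    ⟨(a, b), Finset.mem_offDiag.2 ⟨ha, hb, hab⟩⟩
  exact ⟨dist p.1 p.2, dist_pos.2 (Finset.mem_offDiag.1 hp).2.2,
    fun x hx y hy hxy => hmin (x, y) (Finset.mem_offDiag.2 ⟨hx, hy, hxy⟩)⟩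

theorem exists_mem_far_from_codepoints {S : Finset H} (hS : k < S.card) {s : ℝ}
    (hs : ∀ x ∈ S, ∀ y ∈ S, x ≠ y → s ≤ dist x y) (c : Fin k → H) :
    ∃ x ∈ S, ∀ j, s / 2 ≤ ‖x - c j‖ := by
  by_contra! h
  have : Nonempty (Fin k) := by
    obtain ⟨x, hx⟩ := Finset.card_pos.1 (by omega : 0 < S.card)
    exact ⟨(h x hx).choose⟩
  choose! f hf using h
  obtain ⟨x, hx, y, hy, hxy, hfxy⟩ := Finset.exists_ne_map_eq_of_card_lt_of_maps_to
    (t := (Finset.univ : Finset (Fin k))) (by simpa using hS) (f := f)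
    (fun x _ => Finset.mem_univ (f x))
  have h1 := hf x hx
  have h2 := hf y hy
  rw [hfxy, ← dist_eq_norm] at h1
  rw [← dist_eq_norm] at h2
  linarith [hs x hx y hy hxy, dist_triangle_right x y (c (f y))]

/-- The cells of optimal codebooks have uniformly positive mass. -/
theorem exists_pos_le_measureReal_Wcell [NeZero k] (hP : ∀ᵐ x ∂P, ‖x‖ ≤ M)
    (hsupp : SupportMoreThan P k) :
    ∃ τ : ℝ, 0 < τ ∧ ∀ c ∈ optimal P k, ∀ i, τ ≤ P.real (Wcell k c i) := by
  obtain ⟨S, hcard, hS⟩ := hsupp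
  have hk : 0 < k := Nat.pos_of_ne_zero (NeZero.ne k)
  have hSne : S.Nonempty := Finset.card_pos.1 (by omega)
  obtain ⟨s, hs, hsep⟩ := exists_separation (S := S) (by omega)
  obtain ⟨x₁, hx₁, hmin⟩ := Finset.exists_min_image S (fun x => P.real (ball x (s / 8))) hSne
  obtain ⟨x₂, -, hmax⟩ := Finset.exists_max_image S (fun x => (M + ‖x‖) ^ 2) hSne
  set m := P.real (ball x₁ (s / 8))
  set L := (M + ‖x₂‖) ^ 2
  have hm : 0 < m := ENNReal.toReal_pos (hS x₁ hx₁ _ (by positivity)).ne' (measure_ne_top _ _)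
  have hL : 0 ≤ L := sq_nonneg _
  refine ⟨s ^ 2 / 8 * m / (L + s ^ 2 / 8), by positivity, fun c hc i => ?_⟩
  obtain ⟨x, hxS, hx⟩ := exists_mem_far_from_codepoints hcard hsep c
  set c' := Function.update c i x
  have hpt : ∀ᵐ y ∂P, minSqDist k c' y ≤ minSqDist k c y +
      (Wcell k c i).indicator (fun _ => L + s ^ 2 / 8) y -
      (ball x (s / 8)).indicator (fun _ => s ^ 2 / 8) y := by
    filter_upwards [hP] with y hy
    have hself : minSqDist k c' y ≤ ‖y - x‖ ^ 2 := by
      simpa [c'] using minSqDist_le c' y i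
    have hnn := minSqDist_nonneg c y
    have hball : (ball x (s / 8)).indicator (fun _ => s ^ 2 / 8) y ≤ s ^ 2 / 8 :=
      Set.indicator_le_self' (fun _ _ => by positivity) y
    by_cases hyi : y ∈ Wcell k c i
    · have : ‖y - x‖ ^ 2 ≤ L := by
        refine le_trans ?_ (hmax x hxS)
        gcongr
        linarith [norm_sub_le y x]
      rw [Set.indicator_of_mem hyi]
      linarith
    · rw [Set.indicator_of_notMem hyi]
      obtain ⟨j, hj⟩ := exists_mem_Wcell c y
      have hij : i ≠ j := fun h => hyi (h ▸ hj)
      by_cases hyb : y ∈ ball x (s / 8)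
      · rw [Set.indicator_of_mem hyb]
        rw [mem_ball, dist_eq_norm] at hyb
        have h1 : 3 * s / 8 ≤ ‖y - c j‖ := by
          have := hx j
          have h3 : x - c j = (y - c j) - (y - x) := by abel
          rw [h3] at this
          linarith [norm_sub_le (y - c j) (y - x)]
        have h2 : ‖y - x‖ ^ 2 ≤ (s / 8) ^ 2 := by gcongr
        have h3 : (3 * s / 8) ^ 2 ≤ minSqDist k c y := by
          rw [minSqDist_eq_of_mem_Wcell hj]
          gcongr
        linarith
      · rw [Set.indicator_of_notMem hyb]
        have := minSqDist_update_le (x := x) hij hj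
        linarith
  have hi1 : Integrable ((Wcell k c i).indicator fun _ => L + s ^ 2 / 8) P :=
    (integrable_const _).indicator (measurableSet_Wcell c i)
  have hi2 : Integrable ((ball x (s / 8)).indicator fun _ => s ^ 2 / 8) P :=
    (integrable_const _).indicator measurableSet_ball
  have hint := integral_mono_ae (integrable_minSqDist hP c')
    (((integrable_minSqDist hP c).add hi1).sub hi2) hpt
  have hopt : ∫ y, minSqDist k c y ∂P ≤ ∫ y, minSqDist k c' y ∂P := hc c'
  rw [integral_sub' ((integrable_minSqDist hP c).add hi1) hi2,
    integral_add' (integrable_minSqDist hP c) hi1,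
    integral_indicator_const _ (measurableSet_Wcell c i),
    integral_indicator_const _ measurableSet_ball, smul_eq_mul, smul_eq_mul] at hint
  have hmx : m ≤ P.real (ball x (s / 8)) := hmin x hxS
  rw [div_le_iff₀ (by positivity)]
  nlinarith [mul_le_mul_of_nonneg_left hmx (by positivity : 0 ≤ s ^ 2 / 8)]

theorem norm_le_of_mem_stationary (hP : ∀ᵐ x ∂P, ‖x‖ ≤ M) {c : Fin k → H}
    (hc : c ∈ stationary P k) {i : Fin k} (hi : 0 < P.real (Wcell k c i)) : ‖c i‖ ≤ M := by
  have h1 : P.real (Wcell k c i) • c i = ∫ x in Wcell k c i, x ∂P := hc i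
  have h2 := norm_setIntegral_id_le hP (Wcell k c i)
  rw [← h1, norm_smul, Real.norm_of_nonneg hi.le, mul_comm] at h2
  exact le_of_mul_le_mul_right h2 hi

end OptimalCells

section Margin

variable {k : ℕ} {M r₀ : ℝ} {P : Measure H} [IsProbabilityMeasure P]

theorem Bsep_le {c : Fin k → H} (hc : c ∈ optimal P k) {i j : Fin k} (hij : i ≠ j) :
    Bsep P k ≤ ‖c i - c j‖ :=
  csInf_le ⟨0, by rintro _ ⟨c, -, i, j, -, rfl⟩; exact norm_nonneg _⟩ ⟨c, hc, i, j, hij, rfl⟩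

theorem pmin_le {c : Fin k → H} (hc : c ∈ optimal P k) (i : Fin k) :
    pmin P k ≤ P.real (voronoi k c i) :=
  csInf_le ⟨0, by rintro _ ⟨c, -, i, rfl⟩; exact ENNReal.toReal_nonneg⟩ ⟨c, hc, i, rfl⟩

theorem le_pweight {c : Fin k → H} (hc : c ∈ optimal P k) (t : ℝ) :
    P.real {x | infDist x (Ncrit k c) ≤ t} ≤ pweight P k t :=
  le_csSup ⟨1, by rintro _ ⟨c, -, rfl⟩; exact measureReal_le_one⟩ ⟨c, hc, rfl⟩

theorem MarginCondition.measureReal_infDist_le (h : MarginCondition P k M r₀)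
    {c : Fin k → H} (hc : c ∈ optimal P k) {t : ℝ} (ht : 0 ≤ t) (htr : t ≤ r₀) :
    P.real {x | infDist x (Ncrit k c) ≤ t} ≤ Bsep P k * pmin P k * t / (128 * M ^ 2) :=
  (le_pweight hc t).trans (h.2.2 t ht htr)

theorem MarginCondition.measureReal_Wcell (h : MarginCondition P k M r₀)
    {c : Fin k → H} (hc : c ∈ optimal P k) (i : Fin k) :
    P.real (Wcell k c i) = P.real (voronoi k c i) := by
  have h0 : P.real {x | infDist x (Ncrit k c) ≤ 0} ≤ 0 := by
    simpa using h.measureReal_infDist_le hc le_rfl h.1.le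
  refine le_antisymm (measureReal_mono Set.sdiff_subset) ?_
  have h1 : P.real (Ncrit k c) ≤ P.real {x | infDist x (Ncrit k c) ≤ 0} :=
    measureReal_mono fun x hx => (infDist_zero_of_mem hx).le
  calc P.real (voronoi k c i) ≤ P.real (Wcell k c i ∪ Ncrit k c) :=
        measureReal_mono (voronoi_subset_Wcell_union_Ncrit c i)
    _ ≤ P.real (Wcell k c i) + P.real (Ncrit k c) := measureReal_union_le _ _
    _ ≤ P.real (Wcell k c i) := by linarith

theorem MarginCondition.one_lt (h : MarginCondition P k M r₀) (hne : (optimal P k).Nonempty) :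
    1 < k := by
  by_contra! hk
  obtain ⟨c, hc⟩ := hne
  have hN : Ncrit k c = ∅ := by
    simp only [Ncrit, Set.iUnion_eq_empty]
    intro i j hij
    exact absurd (Fin.ext (by omega)) hij
  have := h.measureReal_infDist_le hc le_rfl h.1.le
  simp [hN] at this
  linarith

theorem pmin_pos [NeZero k] (hP : ∀ᵐ x ∂P, ‖x‖ ≤ M) (hsupp : SupportMoreThan P k)
    (hne : (optimal P k).Nonempty) : 0 < pmin P k := by
  obtain ⟨τ, hτ, hle⟩ := exists_pos_le_measureReal_Wcell hP hsupp
  obtain ⟨c, hc⟩ := hne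
  refine hτ.trans_le (le_csInf ⟨_, c, hc, 0, rfl⟩ ?_)
  rintro _ ⟨c, hc, i, rfl⟩
  exact (hle c hc i).trans (measureReal_mono Set.sdiff_subset)

theorem measureReal_Wcell_pos [NeZero k] (hP : ∀ᵐ x ∂P, ‖x‖ ≤ M) (hsupp : SupportMoreThan P k)
    {c : Fin k → H} (hc : c ∈ optimal P k) (i : Fin k) : 0 < P.real (Wcell k c i) :=
  have ⟨_, hτ, hle⟩ := exists_pos_le_measureReal_Wcell hP hsupp
  hτ.trans_le (hle c hc i)

theorem injective_of_mem_optimal [NeZero k] (hP : ∀ᵐ x ∂P, ‖x‖ ≤ M)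
    (hsupp : SupportMoreThan P k) {c : Fin k → H} (hc : c ∈ optimal P k) :
    Function.Injective c :=
  injective_of_Wcell_nonempty fun i => nonempty_of_measureReal_ne_zero
    (measureReal_Wcell_pos hP hsupp hc i).ne'

theorem norm_le_of_mem_optimal [NeZero k] (hP : ∀ᵐ x ∂P, ‖x‖ ≤ M)
    (hsupp : SupportMoreThan P k) {c : Fin k → H} (hc : c ∈ optimal P k) (i : Fin k) :
    ‖c i‖ ≤ M :=
  norm_le_of_mem_stationary hP (optimal_subset_stationary hP hc)
    (measureReal_Wcell_pos hP hsupp hc i)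

theorem Bsep_nonneg : 0 ≤ Bsep P k :=
  Real.sInf_nonneg (by rintro _ ⟨c, -, i, j, -, rfl⟩; exact norm_nonneg _)

theorem MarginCondition.Bsep_pos (h : MarginCondition P k M r₀) (hsupp : SupportMoreThan P k)
    (hne : (optimal P k).Nonempty) : 0 < Bsep P k := by
  have hk := h.one_lt hne
  have : NeZero k := ⟨by omega⟩
  have hP := h.2.1.ae_norm_le
  refine lt_of_le_of_ne Bsep_nonneg fun hB => ?_
  suffices 2 * r₀ ≤ Bsep P k by linarith [h.1]
  obtain ⟨c₀, hc₀⟩ := hne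
  refine le_csInf ⟨_, c₀, hc₀, ⟨0, by omega⟩, ⟨1, hk⟩, by simp, rfl⟩ ?_
  rintro _ ⟨c, hc, i, j, hij, rfl⟩
  have hnull : P.real {x | infDist x (Ncrit k c) ≤ r₀} = 0 := by
    refine le_antisymm ?_ measureReal_nonneg
    simpa [← hB] using h.measureReal_infDist_le hc h.1.le le_rfl
  have hae : ∀ᵐ x ∂P, r₀ < infDist x (Ncrit k c) := by
    filter_upwards [measure_eq_zero_iff_ae_notMem.1 ((measureReal_eq_zero_iff).1 hnull)] with x hx
    simpa using hx
  have hcij : c i ≠ c j := (injective_of_mem_optimal hP hsupp hc).ne hij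
  have hpos := measureReal_Wcell_pos hP hsupp hc i
  have hcent := setIntegral_norm_sub_sq hP (c j)
    (optimal_subset_stationary hP hc i : P.real (Wcell k c i) • c i = _)
  have hmono : ∫ x in Wcell k c i, (‖x - c i‖ ^ 2 + 2 * ‖c i - c j‖ * r₀) ∂P ≤
      ∫ x in Wcell k c i, ‖x - c j‖ ^ 2 ∂P := by
    refine setIntegral_mono_on_ae
      ((integrable_norm_sub_sq hP _).add (integrable_const _)).integrableOn
      (integrable_norm_sub_sq hP _).integrableOn (measurableSet_Wcell c i) ?_
    filter_upwards [hae] with x hx hxi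
    have h1 := infDist_Ncrit_mul_le hcij (hxi.1 j)
    have h2 : 2 * ‖c i - c j‖ * r₀ ≤ 2 * ‖c i - c j‖ * infDist x (Ncrit k c) := by gcongr
    linarith
  rw [integral_add (integrable_norm_sub_sq hP _).integrableOn (integrable_const _), hcent,
    setIntegral_const, smul_eq_mul, norm_sub_rev (c j)] at hmono
  have hn : 0 < ‖c i - c j‖ := norm_pos_iff.2 (sub_ne_zero.2 hcij)
  have h3 : P.real (Wcell k c i) * ‖c i - c j‖ * (2 * r₀) ≤
      P.real (Wcell k c i) * ‖c i - c j‖ * ‖c i - c j‖ := by linarith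
  exact le_of_mul_le_mul_left h3 (by positivity)

theorem MarginCondition.Bsep_le_two_mul (h : MarginCondition P k M r₀)
    (hsupp : SupportMoreThan P k) (hne : (optimal P k).Nonempty) : Bsep P k ≤ 2 * M := by
  have hk := h.one_lt hne
  have : NeZero k := ⟨by omega⟩
  have hP := h.2.1.ae_norm_le
  obtain ⟨c, hc⟩ := hne
  have hij : (⟨0, by omega⟩ : Fin k) ≠ ⟨1, hk⟩ := by simp
  linarith [Bsep_le hc hij, norm_sub_le (c ⟨0, by omega⟩) (c ⟨1, hk⟩),
    norm_le_of_mem_optimal hP hsupp hc ⟨0, by omega⟩,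
    norm_le_of_mem_optimal hP hsupp hc ⟨1, hk⟩]

theorem MarginCondition.radius_le_two_mul (h : MarginCondition P k M r₀) (hM : 0 < M)
    (hsupp : SupportMoreThan P k) (hne : (optimal P k).Nonempty) : r₀ ≤ 2 * M := by
  by_contra! hr
  have hB := h.Bsep_le_two_mul hsupp hne
  have hk := h.one_lt hne
  have : NeZero k := ⟨by omega⟩
  have hP := h.2.1.ae_norm_le
  obtain ⟨c, hc⟩ := hne
  set i : Fin k := ⟨0, by omega⟩
  set j : Fin k := ⟨1, hk⟩
  have hi := norm_le_of_mem_optimal hP hsupp hc i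
  have hj := norm_le_of_mem_optimal hP hsupp hc j
  have hmem : (2⁻¹ : ℝ) • (c i + c j) ∈ Ncrit k c := by
    simp only [Ncrit, Set.mem_iUnion]
    refine ⟨i, j, by simp [i, j], ?_⟩
    have h1 : (2⁻¹ : ℝ) • (c i + c j) - c i = (2⁻¹ : ℝ) • (c j - c i) := by module
    have h2 : (2⁻¹ : ℝ) • (c i + c j) - c j = (2⁻¹ : ℝ) • (c i - c j) := by module
    simp only [Set.mem_ofPred_eq, h1, h2, norm_smul, norm_sub_rev (c i)]
  have hone : P.real {x | infDist x (Ncrit k c) ≤ 2 * M} = 1 := by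
    rw [measureReal_def, measure_congr (Filter.eventuallyEq_univ.2 ?_), measure_univ,
      ENNReal.toReal_one]
    filter_upwards [hP] with x hx
    refine (infDist_le_dist_of_mem hmem).trans ?_
    rw [dist_eq_norm]
    refine (norm_sub_le _ _).trans ?_
    rw [norm_smul]
    norm_num
    linarith [norm_add_le (c i) (c j)]
  have h1 := h.measureReal_infDist_le hc (by positivity) hr.le
  have hp : pmin P k ≤ 1 := (pmin_le hc i).trans measureReal_le_one
  rw [hone, le_div_iff₀ (by positivity)] at h1
  have : Bsep P k * pmin P k ≤ 2 * M * 1 :=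
    mul_le_mul hB hp (Real.sInf_nonneg (by rintro _ ⟨c, -, i, rfl⟩; exact ENNReal.toReal_nonneg))
      (by positivity)
  nlinarith

end Margin

section LocalGrowth

variable {k : ℕ} {M r₀ : ℝ} {P : Measure H} [IsProbabilityMeasure P]

theorem norm_sub_le_cbDist (c c' : Fin k → H) (i : Fin k) : ‖c i - c' i‖ ≤ cbDist k c c' :=
  Real.le_sqrt_of_sq_le <|
    Finset.single_le_sum (f := fun i => ‖c i - c' i‖ ^ 2) (fun _ _ => sq_nonneg _)
      (Finset.mem_univ i)

theorem cbDist_sq (c c' : Fin k → H) : cbDist k c c' ^ 2 = ∑ j, ‖c j - c' j‖ ^ 2 :=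
  Real.sq_sqrt (Finset.sum_nonneg fun _ _ => sq_nonneg _)

theorem cbDist_nonneg (c c' : Fin k → H) : 0 ≤ cbDist k c c' := Real.sqrt_nonneg _

/-- Using the cells of `c'` instead of those of `c` costs at most `8 M ‖c - c'‖`, and costs
nothing away from the skeleton of `c'`. -/
theorem norm_sub_sq_le_minSqDist_add {c c' : Fin k → H} {b : ℝ} (hb : 0 < b)
    (hsep : ∀ i j, i ≠ j → b ≤ ‖c' i - c' j‖) (hc : ∀ i, ‖c i‖ ≤ M) (hc' : ∀ i, ‖c' i‖ ≤ M)
    {x : H} (hx : ‖x‖ ≤ M) {i : Fin k} (hi : x ∈ voronoi k c' i) :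
    ‖x - c i‖ ^ 2 ≤ minSqDist k c x +
      {y | infDist y (Ncrit k c') ≤ 4 * M * cbDist k c c' / b}.indicator
        (fun _ => 8 * M * cbDist k c c') x := by
  have : NeZero k := ⟨by rintro rfl; exact i.elim0⟩
  have hM : 0 ≤ M := (norm_nonneg x).trans hx
  have hD := cbDist_nonneg c c'
  have hind : 0 ≤ {y | infDist y (Ncrit k c') ≤ 4 * M * cbDist k c c' / b}.indicator
      (fun _ => 8 * M * cbDist k c c') x := Set.indicator_nonneg (fun _ _ => by positivity) x
  obtain ⟨j, hj⟩ := exists_mem_Wcell c x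
  rw [minSqDist_eq_of_mem_Wcell hj]
  rcases eq_or_ne i j with rfl | hij
  · linarith
  have h1 := (abs_le.1 (norm_sub_sq_sub_norm_sub_sq_le hx (hc i) (hc' i))).2
  have h2 := (abs_le.1 (norm_sub_sq_sub_norm_sub_sq_le hx (hc j) (hc' j))).1
  have h3 := mul_le_mul_of_nonneg_left (norm_sub_le_cbDist c c' i) (by positivity : 0 ≤ 4 * M)
  have h4 := mul_le_mul_of_nonneg_left (norm_sub_le_cbDist c c' j) (by positivity : 0 ≤ 4 * M)
  have hb' := hsep i j hij
  have hne : c' i ≠ c' j := fun h => by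
    rw [h, sub_self, norm_zero] at hb'
    linarith
  have h5 := infDist_Ncrit_mul_le hne (hi j)
  have h6 : b * infDist x (Ncrit k c') ≤ ‖c' i - c' j‖ * infDist x (Ncrit k c') :=
    mul_le_mul_of_nonneg_right hb' infDist_nonneg
  by_cases hxN : infDist x (Ncrit k c') ≤ 4 * M * cbDist k c c' / b
  · rw [Set.indicator_of_mem (by exact hxN)]
    have : 0 ≤ b * infDist x (Ncrit k c') := mul_nonneg hb.le infDist_nonneg
    linarith
  · rw [Set.indicator_of_notMem (by exact hxN)]
    rw [not_le, div_lt_iff₀ hb] at hxN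
    linarith

/-- Quadratic growth of the distortion around optimal codebooks. -/
theorem MarginCondition.quadratic_growth (h : MarginCondition P k M r₀) (hM : 0 < M)
    (hsupp : SupportMoreThan P k) {c cs : Fin k → H} (hcs : cs ∈ optimal P k)
    (hc : ∀ i, ‖c i‖ ≤ M) (hd : 4 * M * cbDist k c cs ≤ Bsep P k * r₀) :
    pmin P k / 2 * cbDist k c cs ^ 2 ≤ distortion P k c - distortion P k cs := by
  have hne : (optimal P k).Nonempty := ⟨cs, hcs⟩
  have hk := h.one_lt hne
  have : NeZero k := ⟨by omega⟩
  have hP := h.2.1.ae_norm_le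
  have hB := h.Bsep_pos hsupp hne
  have hp := pmin_pos hP hsupp hne
  have hcsM := norm_le_of_mem_optimal hP hsupp hcs
  set d := cbDist k c cs with hd_def
  have hd0 : 0 ≤ d := cbDist_nonneg c cs
  set E : Set H := {y | infDist y (Ncrit k cs) ≤ 4 * M * d / Bsep P k}
  have hE : MeasurableSet E := measurableSet_le (by fun_prop) measurable_const
  have hPE : P.real E ≤ Bsep P k * pmin P k * (4 * M * d / Bsep P k) / (128 * M ^ 2) :=
    h.measureReal_infDist_le hcs (by positivity) (by rwa [div_le_iff₀ hB, mul_comm r₀])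
  have hcost : 8 * M * d * P.real E ≤ pmin P k / 4 * d ^ 2 := by
    calc 8 * M * d * P.real E
        ≤ 8 * M * d * (Bsep P k * pmin P k * (4 * M * d / Bsep P k) / (128 * M ^ 2)) := by
          gcongr
      _ = pmin P k / 4 * d ^ 2 := by
          field_simp
          ring
  have hEint : Integrable (E.indicator fun _ => 8 * M * d) P :=
    (integrable_const _).indicator hE
  have hassign : assignedDistortion P k cs c ≤ distortion P k c + 8 * M * d * P.real E := by
    have h1 : distortion P k c + 8 * M * d * P.real E =
        ∫ x, (minSqDist k c x + E.indicator (fun _ => 8 * M * d) x) ∂P := by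
      rw [integral_add (integrable_minSqDist hP c) hEint, integral_indicator_const _ hE,
        smul_eq_mul, mul_comm (P.real E)]
      rfl
    have hint : Integrable (fun x => minSqDist k c x + E.indicator (fun _ => 8 * M * d) x) P :=
      (integrable_minSqDist hP c).add hEint
    rw [h1, integral_eq_sum_Wcell cs hint]
    refine Finset.sum_le_sum fun i _ => setIntegral_mono_on_ae
      (integrable_norm_sub_sq hP _).integrableOn
      hint.integrableOn (measurableSet_Wcell cs i) ?_
    filter_upwards [hP] with x hx hxi
    exact norm_sub_sq_le_minSqDist_add hB (fun i j => Bsep_le hcs) hc hcsM hx hxi.1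
  rw [assignedDistortion_eq hP (optimal_subset_stationary hP hcs) c,
    ← distortion_eq_assignedDistortion hP] at hassign
  have hsum : pmin P k * d ^ 2 ≤ ∑ i, P.real (Wcell k cs i) * ‖c i - cs i‖ ^ 2 := by
    rw [cbDist_sq, Finset.mul_sum]
    refine Finset.sum_le_sum fun i _ => mul_le_mul_of_nonneg_right ?_ (sq_nonneg _)
    rw [h.measureReal_Wcell hcs]
    exact pmin_le hcs i
  nlinarith [mul_nonneg hp.le (sq_nonneg d)]

end LocalGrowth

section Compactness

theorem isCompact_closure_setIntegral {P : Measure H} [IsProbabilityMeasure P] {f : H → H}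
    (hf : Integrable f P) :
    IsCompact (closure {v | ∃ A, MeasurableSet A ∧ ∫ x in A, f x ∂P = v}) := by
  refine TotallyBounded.isCompact_of_isClosed (TotallyBounded.closure ?_) isClosed_closure
  refine totallyBounded_iff.2 fun η hη => ?_
  obtain ⟨g, hg, hgf⟩ := (memLp_one_iff_integrable.2 hf).exists_simpleFunc_eLpNorm_sub_lt
    (by simp) (ε := ENNReal.ofReal (η / 2)) (by simpa using hη)
  have hgi : Integrable g P := memLp_one_iff_integrable.1 hgf
  have hdist : ∫ x, ‖f x - g x‖ ∂P < η / 2 := by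
    rw [integral_norm_eq_lintegral_enorm (f := fun x => f x - g x)
      (hf.sub hgi).aestronglyMeasurable]
    rw [eLpNorm_one_eq_lintegral_enorm] at hg
    exact ENNReal.toReal_lt_of_lt_ofReal hg
  have hfin : (insert 0 (Set.range g)).Finite := g.finite_range.insert 0
  obtain ⟨t, ht, hcover⟩ := totallyBounded_iff.1
    (hfin.isCompact_convexHull ℝ).totallyBounded (η / 2) (by positivity)
  refine ⟨t, ht, ?_⟩
  rintro _ ⟨A, hA, rfl⟩
  have hmem : ∫ x in A, g x ∂P ∈ convexHull ℝ (insert 0 (Set.range g)) := by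
    rw [← integral_indicator hA]
    refine (convex_convexHull ℝ _).integral_mem (hfin.isCompact_convexHull ℝ).isClosed
      (Filter.Eventually.of_forall fun x => subset_convexHull ℝ _ ?_) (hgi.indicator hA)
    by_cases hx : x ∈ A
    · rw [Set.indicator_of_mem hx]
      exact Or.inr ⟨x, rfl⟩
    · rw [Set.indicator_of_notMem hx]
      exact Or.inl rfl
  obtain ⟨y, hy, hyd⟩ := Set.mem_iUnion₂.1 (hcover hmem)
  refine Set.mem_iUnion₂.2 ⟨y, hy, ?_⟩
  rw [mem_ball] at hyd ⊢
  have hclose : dist (∫ x in A, f x ∂P) (∫ x in A, g x ∂P) < η / 2 := by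
    rw [dist_eq_norm, ← integral_sub hf.integrableOn hgi.integrableOn]
    refine ((norm_integral_le_integral_norm _).trans ?_).trans_lt hdist
    exact setIntegral_le_integral (hf.sub hgi).norm
      (Filter.Eventually.of_forall fun x => norm_nonneg _)
  linarith [dist_triangle (∫ x in A, f x ∂P) (∫ x in A, g x ∂P) y]

end Compactness

section FarCodebooks

open Filter Topology

variable {k : ℕ} {M r θ : ℝ} {P : Measure H} [IsProbabilityMeasure P]

/-- Codebooks in the ball of radius `M` at distance at least `r` from every optimal codebook. -/
def farCodebooks (P : Measure H) (k : ℕ) (M r : ℝ) : Set (Fin k → H) :=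
  {c | (∀ i, ‖c i‖ ≤ M) ∧ ∀ cs ∈ optimal P k, r ≤ cbDist k c cs}

theorem continuous_cbDist_left (c' : Fin k → H) : Continuous fun c => cbDist k c c' := by
  unfold cbDist
  fun_prop

theorem distortion_lineMap_lloyd_le [NeZero k] (hP : ∀ᵐ x ∂P, ‖x‖ ≤ M) (a : Fin k → H) {t : ℝ}
    (ht : t ∈ Set.Icc (0 : ℝ) 1) :
    distortion P k (AffineMap.lineMap a (lloyd P k a) t) ≤ distortion P k a := by
  have hm := measureReal_smul_lloyd (P := P) a
  refine (distortion_le_assignedDistortion hP a _).trans ?_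
  rw [distortion_eq_assignedDistortion hP a, assignedDistortion_eq hP hm,
    assignedDistortion_eq hP hm a]
  gcongr with i
  have : (AffineMap.lineMap a (lloyd P k a) t : Fin k → H) i - lloyd P k a i =
      (1 - t) • (a i - lloyd P k a i) := by
    simp only [AffineMap.lineMap_apply_module, Pi.add_apply, Pi.smul_apply]
    module
  rw [this, norm_smul, Real.norm_of_nonneg (by linarith [ht.2])]
  exact mul_le_of_le_one_left (norm_nonneg _) (by linarith [ht.1])

/-- Lloyd's algorithm cannot cross a shell of high distortion around the optimal codebooks. -/
theorem lloyd_mem_farCodebooks [NeZero k] (hP : ∀ᵐ x ∂P, ‖x‖ ≤ M)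
    (hgrowth : ∀ c, (∀ i, ‖c i‖ ≤ M) → ∀ cs ∈ optimal P k, cbDist k c cs = r →
      θ ≤ distortion P k c)
    {a : Fin k → H} (ha : a ∈ farCodebooks P k M r) (haθ : distortion P k a < θ) :
    lloyd P k a ∈ farCodebooks P k M r := by
  have hlM := norm_lloyd_le hP ha.1
  refine ⟨hlM, fun cs hcs => ?_⟩
  by_contra! hlt
  have hcont : Continuous fun t : ℝ =>
      cbDist k (AffineMap.lineMap a (lloyd P k a) t) cs :=
    (continuous_cbDist_left cs).comp AffineMap.lineMap_continuous
  obtain ⟨t, ht, htr⟩ := intermediate_value_Icc' (zero_le_one (α := ℝ)) hcont.continuousOn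
    (by simpa using ⟨hlt.le, ha.2 cs hcs⟩ : r ∈ Set.Icc _ _)
  have hball : ∀ i, ‖(AffineMap.lineMap a (lloyd P k a) t : Fin k → H) i‖ ≤ M := by
    intro i
    have hmem := (convex_closedBall (0 : H) M).lineMap_mem (x := a i) (y := lloyd P k a i)
      (by simpa using ha.1 i) (by simpa using hlM i) ht
    rw [mem_closedBall_zero_iff] at hmem
    simpa [AffineMap.lineMap_apply_module] using hmem
  linarith [hgrowth _ hball cs hcs htr, distortion_lineMap_lloyd_le hP a ht]

theorem le_cbDist_of_eq_codepoints {c cs : Fin k → H} {i j : Fin k} (hij : i ≠ j)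
    (hc : c i = c j) (hcs : 2 * r ^ 2 ≤ ‖cs i - cs j‖ ^ 2) : r ≤ cbDist k c cs := by
  refine Real.le_sqrt_of_sq_le ?_
  have h1 : ‖c i - cs i‖ ^ 2 + ‖c j - cs j‖ ^ 2 ≤ ∑ l, ‖c l - cs l‖ ^ 2 := by
    rw [← Finset.sum_pair (f := fun l => ‖c l - cs l‖ ^ 2) hij]
    exact Finset.sum_le_univ_sum_of_nonneg fun _ => sq_nonneg _
  have h2 : ‖cs i - cs j‖ ≤ ‖c i - cs i‖ + ‖c j - cs j‖ := by
    have : cs i - cs j = (c j - cs j) - (c i - cs i) := by rw [hc]; abel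
    rw [this, add_comm]
    exact norm_sub_le _ _
  nlinarith [pow_le_pow_left₀ (norm_nonneg _) h2 2, sq_nonneg (‖c i - cs i‖ - ‖c j - cs j‖)]

/-- The distortion attains its minimum over the codebooks that are far from optimal ones. -/
theorem exists_isMinOn_farCodebooks [NeZero k] (hP : ∀ᵐ x ∂P, ‖x‖ ≤ M)
    (hsep : ∀ cs ∈ optimal P k, ∀ i j, i ≠ j → 2 * r ^ 2 ≤ ‖cs i - cs j‖ ^ 2)
    (hlloyd : ∀ a ∈ farCodebooks P k M r, distortion P k a < θ →
      lloyd P k a ∈ farCodebooks P k M r)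
    {c₀ : Fin k → H} (hc₀ : c₀ ∈ farCodebooks P k M r) (hc₀θ : distortion P k c₀ < θ) :
    ∃ c ∈ farCodebooks P k M r, IsMinOn (distortion P k) (farCodebooks P k M r) c := by
  set F := farCodebooks P k M r
  set I := sInf (distortion P k '' F)
  have hbdd : BddBelow (distortion P k '' F) :=
    ⟨0, by rintro _ ⟨c, -, rfl⟩; exact integral_nonneg (minSqDist_nonneg c)⟩
  have hIθ : I < θ := (csInf_le hbdd ⟨c₀, hc₀, rfl⟩).trans_lt hc₀θ
  have hseq : ∀ n : ℕ, ∃ a ∈ F, distortion P k a < I + 1 / ((n : ℝ) + 1) ∧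
      distortion P k a < θ := by
    intro n
    have hn : (0 : ℝ) < 1 / ((n : ℝ) + 1) := by positivity
    obtain ⟨_, ⟨a, ha, rfl⟩, hlt⟩ := exists_lt_of_csInf_lt (Set.Nonempty.image _ ⟨c₀, hc₀⟩)
      (show I < min (I + 1 / ((n : ℝ) + 1)) θ from lt_min (by linarith) hIθ)
    exact ⟨a, ha, hlt.trans_le (min_le_left _ _), hlt.trans_le (min_le_right _ _)⟩
  choose a haF haI haθ using hseq
  have hcpt : IsCompact (Set.univ.pi fun _ : Fin k => Set.Icc (0 : ℝ) 1 ×ˢ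
      closure {v : H | ∃ A, MeasurableSet A ∧ ∫ x in A, x ∂P = v}) :=
    isCompact_univ_pi fun _ => isCompact_Icc.prod
      (isCompact_closure_setIntegral (integrable_id_of_ae_norm_le hP))
  obtain ⟨z, -, φ, hφ, hz⟩ := hcpt.tendsto_subseq
    (x := fun n i => (P.real (Wcell k (a n) i), ∫ x in Wcell k (a n) i, x ∂P))
    fun n i _ => ⟨⟨measureReal_nonneg, measureReal_le_one⟩,
      subset_closure ⟨_, measurableSet_Wcell _ _, rfl⟩⟩
  have hmass : ∀ i, Tendsto (fun n => P.real (Wcell k (a (φ n)) i)) atTop (𝓝 (z i).1) :=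
    fun i => (continuous_fst.tendsto _).comp (tendsto_pi_nhds.1 hz i)
  have hint : ∀ i, Tendsto (fun n => ∫ x in Wcell k (a (φ n)) i, x ∂P) atTop (𝓝 (z i).2) :=
    fun i => (continuous_snd.tendsto _).comp (tendsto_pi_nhds.1 hz i)
  have hsum : ∑ i, (z i).1 = 1 := by
    refine tendsto_nhds_unique (tendsto_finsetSum _ fun i _ => hmass i) ?_
    simp only [sum_measureReal_Wcell]
    exact tendsto_const_nhds
  obtain ⟨j₀, hj₀⟩ : ∃ j, (z j).1 ≠ 0 := by
    by_contra! h
    simp [h] at hsum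
  set b : ℕ → Fin k → H := fun n => lloyd P k (a (φ n))
  have hbF : ∀ n, b n ∈ F := fun n => hlloyd _ (haF _) (haθ _)
  set c : Fin k → H := fun i =>
    if (z i).1 = 0 then (z j₀).1⁻¹ • (z j₀).2 else (z i).1⁻¹ • (z i).2 with hc_def
  have hlim : ∀ i, (z i).1 ≠ 0 → Tendsto (fun n => b n i) atTop (𝓝 (c i)) := by
    intro i hi
    have h1 : c i = (z i).1⁻¹ • (z i).2 := if_neg hi
    rw [h1]
    refine (((hmass i).inv₀ hi).smul (hint i)).congr' ?_
    filter_upwards [(hmass i).eventually_ne hi] with n hn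
    exact (if_neg hn).symm
  have hdup : ∀ i, (z i).1 = 0 → c i = c j₀ := fun i hi => by simp [c, hi]
  have hcM' : ∀ i, (z i).1 ≠ 0 → ‖c i‖ ≤ M := fun i hi =>
    le_of_tendsto' (hlim i hi).norm fun n => (hbF n).1 i
  have hcM : ∀ i, ‖c i‖ ≤ M := by
    intro i
    by_cases hi : (z i).1 = 0
    · rw [hdup i hi]
      exact hcM' j₀ hj₀
    · exact hcM' i hi
  have hcF : c ∈ F := by
    refine ⟨hcM, fun cs hcs => ?_⟩
    by_cases hall : ∃ i, (z i).1 = 0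
    · obtain ⟨i, hi⟩ := hall
      have hij : i ≠ j₀ := by rintro rfl; exact hj₀ hi
      exact le_cbDist_of_eq_codepoints hij (hdup i hi) (hsep cs hcs i j₀ hij)
    · push Not at hall
      have hb : Tendsto b atTop (𝓝 c) := tendsto_pi_nhds.2 fun i => hlim i (hall i)
      exact ge_of_tendsto' (((continuous_cbDist_left cs).tendsto c).comp hb)
        fun n => (hbF n).2 cs hcs
  have hle : ∀ n, distortion P k c ≤ I + 1 / ((φ n : ℝ) + 1) +
      ∑ i, P.real (Wcell k (a (φ n)) i) * ‖c i - b n i‖ ^ 2 := by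
    intro n
    have hm := measureReal_smul_lloyd (P := P) (a (φ n))
    have h1 := distortion_le_assignedDistortion hP (a (φ n)) c
    have h2 := assignedDistortion_eq hP hm (a (φ n))
    rw [assignedDistortion_eq hP hm c] at h1
    rw [← distortion_eq_assignedDistortion hP] at h2
    have h3 : 0 ≤ ∑ i, P.real (Wcell k (a (φ n)) i) *
        ‖a (φ n) i - lloyd P k (a (φ n)) i‖ ^ 2 :=
      Finset.sum_nonneg fun i _ => mul_nonneg measureReal_nonneg (sq_nonneg _)
    linarith [haI (φ n)]
  have hterm : ∀ i, Tendsto (fun n => P.real (Wcell k (a (φ n)) i) * ‖c i - b n i‖ ^ 2) atTop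
      (𝓝 0) := by
    intro i
    by_cases hi : (z i).1 = 0
    · have h1 := (hmass i).mul_const ((2 * M) ^ 2)
      rw [hi, zero_mul] at h1
      refine squeeze_zero (fun n => by positivity) (fun n => ?_) h1
      gcongr
      linarith [norm_sub_le (c i) (b n i), hcM i, (hbF n).1 i]
    · have h1 := (hmass i).mul (((hlim i hi).const_sub (c i)).norm.pow 2)
      simpa using h1
  have hcI : distortion P k c ≤ I := by
    refine ge_of_tendsto' (x := atTop) ?_ hle
    have h1 : Tendsto (fun n => 1 / ((φ n : ℝ) + 1)) atTop (𝓝 0) :=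
      tendsto_one_div_add_atTop_nhds_zero_nat.comp hφ.tendsto_atTop
    have h2 := (h1.const_add I).add (tendsto_finsetSum Finset.univ fun i _ => hterm i)
    simpa using h2
  exact ⟨c, hcF, fun c' hc' => hcI.trans (csInf_le hbdd ⟨c', hc', rfl⟩)⟩

end FarCodebooks

section Comparison

variable {k : ℕ} {M r₀ ε : ℝ} {P : Measure H} [IsProbabilityMeasure P]

theorem abs_minSqDist_sub_le [NeZero k] {c c' : Fin k → H} (hc : ∀ i, ‖c i‖ ≤ M)
    (hc' : ∀ i, ‖c' i‖ ≤ M) {x : H} (hx : ‖x‖ ≤ M) :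
    |minSqDist k c x - minSqDist k c' x| ≤ 4 * M * cbDist k c c' := by
  have hM : 0 ≤ M := (norm_nonneg x).trans hx
  obtain ⟨i, hi⟩ := exists_mem_Wcell c x
  obtain ⟨j, hj⟩ := exists_mem_Wcell c' x
  have hi' := minSqDist_le c' x i
  have hj' := minSqDist_le c x j
  have h1 := (abs_le.1 (norm_sub_sq_sub_norm_sub_sq_le hx (hc i) (hc' i))).1
  have h2 := (abs_le.1 (norm_sub_sq_sub_norm_sub_sq_le hx (hc j) (hc' j))).2
  have h3 := mul_le_mul_of_nonneg_left (norm_sub_le_cbDist c c' i) (by positivity : 0 ≤ 4 * M)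
  have h4 := mul_le_mul_of_nonneg_left (norm_sub_le_cbDist c c' j) (by positivity : 0 ≤ 4 * M)
  rw [abs_le]
  constructor
  · linarith [minSqDist_eq_of_mem_Wcell hi]
  · linarith [minSqDist_eq_of_mem_Wcell hj]

theorem variance_minSqDist_sub_le [NeZero k] (hP : ∀ᵐ x ∂P, ‖x‖ ≤ M) {c c' : Fin k → H}
    (hc : ∀ i, ‖c i‖ ≤ M) (hc' : ∀ i, ‖c' i‖ ≤ M) :
    ProbabilityTheory.variance (fun x => minSqDist k c x - minSqDist k c' x) P ≤
      16 * M ^ 2 * ∑ j, ‖c j - c' j‖ ^ 2 := by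
  have hmeas : Measurable fun x => minSqDist k c x - minSqDist k c' x :=
    (measurable_minSqDist c).sub (measurable_minSqDist c')
  refine (ProbabilityTheory.variance_le_expectation_sq hmeas.aestronglyMeasurable).trans ?_
  rw [← cbDist_sq]
  have hbound : ∀ᵐ x ∂P, ‖((fun x => minSqDist k c x - minSqDist k c' x) ^ 2) x‖ ≤
      16 * M ^ 2 * cbDist k c c' ^ 2 := by
    filter_upwards [hP] with x hx
    have h := pow_le_pow_left₀ (abs_nonneg _) (abs_minSqDist_sub_le hc hc' hx) 2
    rw [Pi.pow_apply, norm_pow, Real.norm_eq_abs]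
    linarith
  have := norm_integral_le_of_norm_le_const hbound
  rw [probReal_univ, mul_one] at this
  exact (le_abs_self _).trans this

theorem exists_cbDist_lt_of_separated (hM : 0 < M) (hsupp : SupportMoreThan P k)
    (hmargin : MarginCondition P k M r₀) (hsep : Separated P k ε) {c cs : Fin k → H}
    (hc : ∀ i, ‖c i‖ ≤ M) (hcs : cs ∈ optimal P k)
    (hε : distortion P k c - distortion P k cs < ε)
    (hr : distortion P k c - distortion P k cs <
      pmin P k / 2 * (Bsep P k * r₀ / (4 * M)) ^ 2) :
    ∃ cs' ∈ optimal P k, cbDist k c cs' < Bsep P k * r₀ / (4 * M) := by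
  by_contra! hfar
  have hne : (optimal P k).Nonempty := ⟨cs, hcs⟩
  have : NeZero k := ⟨by have := hmargin.one_lt hne; omega⟩
  have hP := hmargin.2.1.ae_norm_le
  have hB := hmargin.Bsep_pos hsupp hne
  have hr₀ := hmargin.1
  have hr₀M := hmargin.radius_le_two_mul hM hsupp hne
  set r := Bsep P k * r₀ / (4 * M) with hr_def
  have hrpos : 0 < r := by positivity
  have hrB : 2 * r ^ 2 ≤ Bsep P k ^ 2 := by
    have h1 : r ≤ Bsep P k / 2 := by
      rw [hr_def, div_le_iff₀ (by positivity)]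
      nlinarith
    nlinarith
  have hopt : ∀ c' ∈ optimal P k, distortion P k c' = distortion P k cs :=
    fun c' hc' => le_antisymm (hc' cs) (hcs c')
  have hgrowth : ∀ c, (∀ i, ‖c i‖ ≤ M) → ∀ c' ∈ optimal P k, cbDist k c c' = r →
      distortion P k cs + pmin P k / 2 * r ^ 2 ≤ distortion P k c := by
    intro c hc c' hc' hd
    have := hmargin.quadratic_growth hM hsupp hc' hc
      (by rw [hd, hr_def, mul_div_cancel₀ _ (by positivity)])
    rw [hd, hopt c' hc'] at this
    linarith
  have hlloyd : ∀ a ∈ farCodebooks P k M r,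
      distortion P k a < distortion P k cs + pmin P k / 2 * r ^ 2 →
        lloyd P k a ∈ farCodebooks P k M r :=
    fun a ha => lloyd_mem_farCodebooks hP hgrowth ha
  have hcF : c ∈ farCodebooks P k M r := ⟨hc, hfar⟩
  obtain ⟨a, haF, hmin⟩ := exists_isMinOn_farCodebooks hP
    (fun c' hc' i j hij => hrB.trans (pow_le_pow_left₀ hB.le (Bsep_le hc' hij) 2))
    hlloyd hcF (by linarith)
  have hac : distortion P k a ≤ distortion P k c := hmin hcF
  have hstat : a ∈ stationary P k :=
    mem_stationary_of_distortion_le_lloyd hP (hmin (hlloyd a haF (by linarith)))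
  have hnot : a ∉ optimal P k := fun ha => by
    have := haF.2 a ha
    simp only [cbDist, sub_self, norm_zero] at this
    norm_num at this
    linarith
  linarith [hsep a ⟨hstat, hnot⟩ cs hcs]

theorem sum_norm_sub_sq_le_of_separated (hM : 0 < M) (hsupp : SupportMoreThan P k)
    (hmargin : MarginCondition P k M r₀) (hε : 0 < ε) (hsep : Separated P k ε)
    {c cs : Fin k → H} (hc : ∀ i, ‖c i‖ ≤ M) (hcs : cs ∈ optimal P k)
    (hclosest : ∀ c' ∈ optimal P k, cbDist k c cs ≤ cbDist k c c') :
    ∑ j, ‖c j - cs j‖ ^ 2 ≤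
      4 * k * M ^ 2 * max (1 / ε) (64 * M ^ 2 / (pmin P k * Bsep P k ^ 2 * r₀ ^ 2)) *
        (distortion P k c - distortion P k cs) := by
  have hne : (optimal P k).Nonempty := ⟨cs, hcs⟩
  have hk := hmargin.one_lt hne
  have : NeZero k := ⟨by omega⟩
  have hP := hmargin.2.1.ae_norm_le
  have hB := hmargin.Bsep_pos hsupp hne
  have hp := pmin_pos hP hsupp hne
  have hr₀ := hmargin.1
  have hr₀M := hmargin.radius_le_two_mul hM hsupp hne
  have hBM := hmargin.Bsep_le_two_mul hsupp hne
  have hcsM := norm_le_of_mem_optimal hP hsupp hcs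
  have hk1 : (1 : ℝ) ≤ k := by exact_mod_cast hk.le
  set δ := distortion P k c - distortion P k cs with hδ
  have hδ0 : 0 ≤ δ := sub_nonneg.2 (hcs c)
  set K := max (1 / ε) (64 * M ^ 2 / (pmin P k * Bsep P k ^ 2 * r₀ ^ 2))
  have hdiam : ∑ j, ‖c j - cs j‖ ^ 2 ≤ 4 * k * M ^ 2 := by
    calc ∑ j, ‖c j - cs j‖ ^ 2 ≤ ∑ _j : Fin k, (2 * M) ^ 2 := by
          gcongr with j
          linarith [norm_sub_le (c j) (cs j), hc j, hcsM j]
      _ = 4 * k * M ^ 2 := by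
          rw [Finset.sum_const, Finset.card_univ, Fintype.card_fin, nsmul_eq_mul]
          ring
  have hlarge : 1 ≤ K * δ → ∑ j, ‖c j - cs j‖ ^ 2 ≤ 4 * k * M ^ 2 * K * δ := by
    intro h
    rw [mul_assoc]
    exact hdiam.trans (le_mul_of_one_le_right (by positivity) h)
  rcases le_or_gt ε δ with hεδ | hεδ
  · apply hlarge
    calc 1 ≤ 1 / ε * δ := by rwa [one_div, ← div_eq_inv_mul, one_le_div hε]
      _ ≤ K * δ := by gcongr; exact le_max_left _ _
  have hK : 64 * M ^ 2 / (pmin P k * Bsep P k ^ 2 * r₀ ^ 2) ≤ K := le_max_right _ _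
  rcases le_or_gt (pmin P k * Bsep P k ^ 2 * r₀ ^ 2 / (64 * M ^ 2)) δ with hτ | hτ
  · apply hlarge
    calc 1 ≤ 64 * M ^ 2 / (pmin P k * Bsep P k ^ 2 * r₀ ^ 2) * δ := by
          rw [div_mul_eq_mul_div, one_le_div (by positivity)]
          rwa [div_le_iff₀' (by positivity)] at hτ
      _ ≤ K * δ := by gcongr
  have hr : δ < pmin P k / 2 * (Bsep P k * r₀ / (4 * M)) ^ 2 := by
    refine hτ.trans_le ?_
    have : pmin P k / 2 * (Bsep P k * r₀ / (4 * M)) ^ 2 =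
        2 * (pmin P k * Bsep P k ^ 2 * r₀ ^ 2 / (64 * M ^ 2)) := by
      field_simp
      ring
    rw [this]
    exact le_mul_of_one_le_left (by positivity) (by norm_num)
  obtain ⟨c', hc', hlt⟩ := exists_cbDist_lt_of_separated hM hsupp hmargin hsep hc hcs hεδ hr
  have hd := (hclosest c' hc').trans hlt.le
  rw [le_div_iff₀ (by positivity), mul_comm] at hd
  have hquad := hmargin.quadratic_growth hM hsupp hcs hc hd
  rw [← cbDist_sq]
  have hK2 : 2 / pmin P k ≤ 4 * k * M ^ 2 * K := by
    calc 2 / pmin P k ≤ 4 * 1 * M ^ 2 *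
          (64 * M ^ 2 / (pmin P k * Bsep P k ^ 2 * r₀ ^ 2)) := by
          have h1 : Bsep P k * r₀ ≤ 2 * M * (2 * M) := by gcongr
          have h2 : (Bsep P k * r₀) ^ 2 ≤ (2 * M * (2 * M)) ^ 2 := by gcongr
          rw [mul_div_assoc', div_le_div_iff₀ hp (by positivity)]
          have h3 := mul_le_mul_of_nonneg_left h2 hp.le
          nlinarith [mul_nonneg hp.le (by positivity : 0 ≤ M ^ 4)]
      _ ≤ 4 * k * M ^ 2 * K := by gcongr
  calc cbDist k c cs ^ 2 ≤ 2 / pmin P k * δ := by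
        rw [div_mul_eq_mul_div, le_div_iff₀ hp]
        linarith
    _ ≤ 4 * k * M ^ 2 * K * δ := by gcongr

end Comparison

end Kmeans

/-- variance/distance/excess-distortion comparisons under the
margin condition. -/
theorem variance_dist_excess_comparison_of_margin
    (P : Measure H) [IsProbabilityMeasure P] (k : ℕ) (M r₀ ε : ℝ)
    (hk : 1 ≤ k) (hM : 0 < M) (hsupp : SupportMoreThan P k)
    (hmargin : MarginCondition P k M r₀) (hε : 0 < ε) (hsep : Separated P k ε) :
    ∀ c : Fin k → H, (∀ j : Fin k, c j ∈ closedBall (0 : H) M) →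
    ∀ ccl ∈ optimal P k, (∀ c' ∈ optimal P k, cbDist k c ccl ≤ cbDist k c c') →
      (1 / (16 * M ^ 2)) *
          ProbabilityTheory.variance
            (fun x => (⨅ j : Fin k, ‖x - c j‖ ^ 2) - ⨅ j : Fin k, ‖x - ccl j‖ ^ 2) P ≤
        ∑ j : Fin k, ‖c j - ccl j‖ ^ 2 ∧
      ∑ j : Fin k, ‖c j - ccl j‖ ^ 2 ≤
        4 * k * M ^ 2 * max (1 / ε) (64 * M ^ 2 / (pmin P k * Bsep P k ^ 2 * r₀ ^ 2)) *
          (distortion P k c - distortion P k ccl) := by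
  intro c hc ccl hccl hclosest
  have hc' : ∀ i, ‖c i‖ ≤ M := fun i => by simpa using hc i
  have hP := hmargin.2.1.ae_norm_le
  have : NeZero k := ⟨by omega⟩
  have hcclM := norm_le_of_mem_optimal hP hsupp hccl
  refine ⟨?_, sum_norm_sub_sq_le_of_separated hM hsupp hmargin hε hsep hc' hccl hclosest⟩
  rw [one_div, inv_mul_le_iff₀ (by positivity)]
  exact variance_minSqDist_sub_le hP hc' hcclM
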